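/- arXiv:1203.4885 — 2 statements merged into one kernel-verified Lean document; each statement's English description precedes it below -/
import Mathlib

section
/- Fix finite nonempty types α and β, a finite type ι, positive semidefinite matrices P : ι → Matrix (α × β) (α × β) ℂ, a positive semidefinite ρ : Matrix β β ℂ with trace 1 such that ∑_i P i = I_α ⊗ ρ, and values v : ι → ℝ. Then for every n ≥ 1, the supremum over all n-repetition strategies X of (1/n) · ∑_{s : Fin n → ι} (∑ⱼ v (s j)) · re (Tr ((⨂ⱼ P (s j)) * X)) equals the supremum over all single-repetition strategies X of ∑_i (v i) · re (Tr (P i * X)). That is, the optimal expected value per repetition of n independent parallel instantiations of a one-round interaction equals the optimal expected value of a single instantiation. -/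
open Matrix Finset ComplexOrder

/-- The `n`-fold Kronecker product of matrices `M 0, …, M (n-1)`, indexed by `Fin n → I`. -/
noncomputable def nKron {n : ℕ} {I : Type*} [Fintype I] (M : Fin n → Matrix I I ℂ) :
    Matrix (Fin n → I) (Fin n → I) ℂ :=
  fun f g => ∏ j, M j (f j) (g j)

/-- A single-repetition strategy for Bob: positive semidefinite, with partial trace over
the answer coordinate equal to the identity on the question coordinate. -/
def IsStrategy {α β : Type*} [Fintype α] [Fintype β] [DecidableEq β]
    (X : Matrix (α × β) (α × β) ℂ) : Prop :=
  X.PosSemidef ∧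
    ∀ b b' : β, ∑ a : α, X (a, b) (a, b') = if b = b' then 1 else 0

/-- An `n`-repetition strategy for Bob. -/
def IsParStrategy {α β : Type*} [Fintype α] [Fintype β] [DecidableEq β] (n : ℕ)
    (X : Matrix (Fin n → α × β) (Fin n → α × β) ℂ) : Prop :=
  X.PosSemidef ∧
    ∀ b b' : Fin n → β,
      ∑ a : Fin n → α, X (fun j => (a j, b j)) (fun j => (a j, b' j)) =
        if b = b' then 1 else 0

theorem nKron_posSemidef {n : ℕ} {I : Type*} [Fintype I] {M : Fin n → Matrix I I ℂ}
    (hM : ∀ j, (M j).PosSemidef) : (nKron M).PosSemidef := by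
  classical
  have hB : ∀ j, ∃ B : Matrix I I ℂ, M j = Bᴴ * B := fun j => by
    open scoped MatrixOrder in
    exact CStarAlgebra.nonneg_iff_eq_star_mul_self.mp (hM j).nonneg
  choose B hB using hB
  have h : nKron M = (nKron B)ᴴ * nKron B := by
    ext f g
    simp only [nKron, Matrix.mul_apply, Matrix.conjTranspose_apply, star_prod,
      ← Finset.prod_mul_distrib]
    rw [← Fintype.prod_sum (fun j x => star (B j x (f j)) * B j x (g j))]
    refine Finset.prod_congr rfl fun j _ => ?_
    rw [hB j]
    simp [Matrix.mul_apply]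
  rw [h]
  exact Matrix.posSemidef_conjTranspose_mul_self _

theorem sum_insertNth {m : ℕ} {I N : Type*} [Fintype I] [AddCommMonoid N] (j : Fin (m + 1))
    (F : (Fin (m + 1) → I) → N) :
    ∑ f, F f = ∑ q : I, ∑ u : Fin m → I, F (j.insertNth q u) := by
  rw [← (Fin.insertNthEquiv (fun _ => I) j).sum_comp, Fintype.sum_prod_type]
  rfl

theorem nKron_insertNth {m : ℕ} {I : Type*} [Fintype I] (j : Fin (m + 1))
    (M : Fin (m + 1) → Matrix I I ℂ) (p q : I) (u w : Fin m → I) :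
    nKron M (j.insertNth p u) (j.insertNth q w) =
      M j p q * nKron (fun k => M (j.succAbove k)) u w := by
  simp [nKron, Fin.prod_univ_succAbove _ j]

theorem prod_mk_insertNth {m : ℕ} {α β : Type*} (j : Fin (m + 1)) (a : α) (b : β)
    (c : Fin m → α) (d : Fin m → β) :
    (fun k => ((j.insertNth a c : Fin (m + 1) → α) k, (j.insertNth b d : Fin (m + 1) → β) k)) =
      (j.insertNth (a, b) fun k => (c k, d k) : Fin (m + 1) → α × β) := by
  funext k
  induction k using Fin.succAboveCases j <;> simp

theorem sum_arrow_prod {m : ℕ} {α β N : Type*} [Fintype α] [Fintype β] [AddCommMonoid N]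
    (F : (Fin m → α × β) → N) :
    ∑ u, F u = ∑ c : Fin m → α, ∑ d : Fin m → β, F fun k => (c k, d k) := by
  rw [← (Equiv.arrowProdEquivProdArrow (Fin m) (fun _ => α) (fun _ => β)).symm.sum_comp,
    Fintype.sum_prod_type]
  rfl

/-- The operator induced on coordinate `j` by `X` when every other coordinate is contracted
with `R`. -/
noncomputable def marginal {m : ℕ} {I : Type*} [Fintype I] (R : Matrix I I ℂ)
    (X : Matrix (Fin (m + 1) → I) (Fin (m + 1) → I) ℂ) (j : Fin (m + 1)) : Matrix I I ℂ :=
  Matrix.of fun q p => ∑ u : Fin m → I, ∑ w : Fin m → I,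
    X (j.insertNth q u) (j.insertNth p w) * nKron (fun _ => R) w u

theorem marginal_posSemidef {m : ℕ} {I : Type*} [Fintype I] {R : Matrix I I ℂ}
    (hR : R.PosSemidef) {X : Matrix (Fin (m + 1) → I) (Fin (m + 1) → I) ℂ}
    (hX : X.PosSemidef) (j : Fin (m + 1)) : (marginal R X j).PosSemidef := by
  classical
  let Z : Matrix (I × (Fin m → I)) (I × (Fin m → I)) ℂ :=
    (X.submatrix (fun x => j.insertNth x.1 x.2) fun x => j.insertNth x.1 x.2).hadamard
      ((nKron fun _ => R)ᵀ.submatrix Prod.snd Prod.snd)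
  have hZ : Z.PosSemidef :=
    (hX.submatrix _).hadamard ((nKron_posSemidef fun _ => hR).transpose.submatrix _)
  let E : Matrix (I × (Fin m → I)) I ℂ := Matrix.of fun x p => if x.1 = p then 1 else 0
  have h : marginal R X j = Eᴴ * Z * E := by
    ext q p
    simp [marginal, Matrix.mul_apply, Z, E, Fintype.sum_prod_type, apply_ite star]
    rw [Finset.sum_comm]
  rw [h]
  exact hZ.conjTranspose_mul_mul_same E

theorem sum_trace_nKron {m : ℕ} {I ι : Type*} [Fintype I] [Fintype ι] (P : ι → Matrix I I ℂ)
    (X : Matrix (Fin (m + 1) → I) (Fin (m + 1) → I) ℂ) (v : ι → ℂ) (j : Fin (m + 1)) :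
    ∑ s : Fin (m + 1) → ι, v (s j) * (nKron (fun k => P (s k)) * X).trace =
      ∑ i, v i * (P i * marginal (∑ i, P i) X j).trace := by
  classical
  have key : ∀ f g : Fin m → I, nKron (fun _ => ∑ i, P i) f g =
      ∑ s : Fin m → ι, nKron (fun k => P (s k)) f g := by
    intro f g
    simp only [nKron, Matrix.sum_apply]
    rw [← Fintype.prod_sum (fun k i => P i (f k) (g k))]
  rw [sum_insertNth j]
  refine Finset.sum_congr rfl fun i _ => ?_
  simp only [Fin.insertNth_apply_same, ← Finset.mul_sum]
  congr 1
  simp only [Matrix.trace, Matrix.diag_apply, Matrix.mul_apply, sum_insertNth j (I := I),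
    nKron_insertNth, Fin.insertNth_apply_same, Fin.insertNth_apply_succAbove, marginal,
    Matrix.of_apply, key, Finset.mul_sum]
  rw [Finset.sum_comm]
  refine Finset.sum_congr rfl fun p _ => ?_
  rw [Finset.sum_comm_cycle]
  refine Finset.sum_congr rfl fun q _ => ?_
  rw [Finset.sum_comm_cycle]
  refine Finset.sum_congr rfl fun u _ => ?_
  rw [Finset.sum_comm]
  refine Finset.sum_congr rfl fun w _ => Finset.sum_congr rfl fun s _ => ?_
  ring

theorem sum_mul_eq_trace {α β : Type*} [Fintype α] [Fintype β] [DecidableEq α] [DecidableEq β]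
    (ρ : Matrix β β ℂ) {X : Matrix (α × β) (α × β) ℂ} (hX : IsStrategy X) :
    ∑ u, ∑ w, X u w *
      (Matrix.of fun p q : α × β => (if p.1 = q.1 then (1 : ℂ) else 0) * ρ p.2 q.2) w u =
      ρ.trace := by
  have h : ∀ b b', ∑ a, X (a, b) (a, b') * ρ b' b = if b = b' then ρ b' b else 0 := by
    intro b b'
    rw [← Finset.sum_mul, hX.2, ite_mul, one_mul, zero_mul]
  calc _ = ∑ b, ∑ b', ∑ a, X (a, b) (a, b') * ρ b' b := by
        simp only [Fintype.sum_prod_type, Matrix.of_apply, ite_mul, one_mul, zero_mul, mul_ite,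
          mul_zero]
        rw [Finset.sum_comm]
        refine Finset.sum_congr rfl fun b _ => ?_
        rw [Finset.sum_comm]
        simp
        rw [Finset.sum_comm]
    _ = _ := by simp [h, Matrix.trace]

theorem nKron_isParStrategy {α β : Type*} [Fintype α] [Fintype β] [DecidableEq β]
    (n : ℕ) {X : Matrix (α × β) (α × β) ℂ} (hX : IsStrategy X) :
    IsParStrategy n (nKron fun _ : Fin n => X) := by
  classical
  refine ⟨nKron_posSemidef fun _ => hX.1, fun b b' => ?_⟩
  simp only [nKron]
  rw [← Fintype.prod_sum (fun j a => X (a, b j) (a, b' j))]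
  simp only [hX.2, Finset.prod_ite_zero, Finset.prod_const_one, funext_iff, Finset.mem_univ,
    true_implies]

theorem sum_nKron_mul_nKron {m : ℕ} {I : Type*} [Fintype I] (X R : Matrix I I ℂ) :
    ∑ u : Fin m → I, ∑ w : Fin m → I, nKron (fun _ => X) u w * nKron (fun _ => R) w u =
      (∑ u, ∑ w, X u w * R w u) ^ m := by
  classical
  simp only [nKron, ← Finset.prod_mul_distrib]
  have h : ∀ u : Fin m → I, ∑ w : Fin m → I, ∏ k, X (u k) (w k) * R (w k) (u k) =
      ∏ k, ∑ x, X (u k) x * R x (u k) := fun u =>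
    (Fintype.prod_sum (fun k x => X (u k) x * R x (u k))).symm
  simp only [h]
  rw [← Fintype.prod_sum (fun (_ : Fin m) y => ∑ x, X y x * R x y)]
  simp

theorem marginal_nKron {α β : Type*} [Fintype α] [Fintype β] [DecidableEq α] [DecidableEq β]
    {ρ : Matrix β β ℂ} (hρ : ρ.trace = 1) {X : Matrix (α × β) (α × β) ℂ} (hX : IsStrategy X)
    {m : ℕ} (j : Fin (m + 1)) :
    marginal (Matrix.of fun p q : α × β => (if p.1 = q.1 then (1 : ℂ) else 0) * ρ p.2 q.2)
      (nKron fun _ => X) j = X := by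
  ext q p
  simp only [marginal, Matrix.of_apply, nKron_insertNth, mul_assoc, ← Finset.mul_sum]
  rw [sum_nKron_mul_nKron, sum_mul_eq_trace ρ hX, hρ, one_pow, mul_one]

theorem marginal_isStrategy {α β : Type*} [Fintype α] [Fintype β] [DecidableEq α]
    [DecidableEq β] {ρ : Matrix β β ℂ} (hρ : ρ.trace = 1) {m : ℕ}
    {X : Matrix (Fin (m + 1) → α × β) (Fin (m + 1) → α × β) ℂ} (hX : IsParStrategy (m + 1) X)
    (hR : (Matrix.of fun p q : α × β =>
      (if p.1 = q.1 then (1 : ℂ) else 0) * ρ p.2 q.2).PosSemidef) (j : Fin (m + 1)) :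
    IsStrategy (marginal (Matrix.of fun p q : α × β =>
      (if p.1 = q.1 then (1 : ℂ) else 0) * ρ p.2 q.2) X j) := by
  refine ⟨marginal_posSemidef hR hX.1 j, fun b b' => ?_⟩
  have hpt : ∀ d e : Fin m → β, ∑ a : α, ∑ c : Fin m → α,
      X (j.insertNth (a, b) fun k => (c k, d k)) (j.insertNth (a, b') fun k => (c k, e k)) =
        if b = b' ∧ d = e then 1 else 0 := by
    intro d e
    have h := hX.2 (j.insertNth b d) (j.insertNth b' e)
    simp only [sum_insertNth j, prod_mk_insertNth, Fin.insertNth_inj] at h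
    exact h
  have hK : ∀ (c c' : Fin m → α) (d e : Fin m → β), nKron (fun _ => Matrix.of fun p q : α × β =>
      (if p.1 = q.1 then (1 : ℂ) else 0) * ρ p.2 q.2) (fun k => (c k, d k))
        (fun k => (c' k, e k)) = if c = c' then nKron (fun _ => ρ) d e else 0 := by
    intro c c' d e
    simp [nKron, Finset.prod_ite_zero, funext_iff]
  calc _ = ∑ d, ∑ e, (∑ a : α, ∑ c : Fin m → α,
      X (j.insertNth (a, b) fun k => (c k, d k)) (j.insertNth (a, b') fun k => (c k, e k))) *
        nKron (fun _ => ρ) e d := by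
        simp only [marginal, Matrix.of_apply, sum_arrow_prod, hK, mul_ite, mul_zero,
          Finset.sum_mul, Finset.sum_ite_irrel, Finset.sum_const_zero,
          Finset.sum_ite_eq', Finset.mem_univ, if_true]
        rw [Finset.sum_comm_cycle]
        refine Finset.sum_congr rfl fun d _ => ?_
        rw [Finset.sum_comm_cycle]
    _ = if b = b' then ∑ d : Fin m → β, nKron (fun _ => ρ) d d else 0 := by
        simp only [hpt]
        by_cases h : b = b' <;> simp [h]
    _ = _ := by
        simp only [nKron]
        rw [← Fintype.prod_sum (fun _ x => ρ x x)]
        have : ∑ x, ρ x x = 1 := hρ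
        simp [this]

theorem isStrategy_average {α β : Type*} [Fintype α] [Fintype β] [DecidableEq β] {n : ℕ}
    (hn : (n : ℝ) ≠ 0) {X : Fin n → Matrix (α × β) (α × β) ℂ} (hX : ∀ j, IsStrategy (X j)) :
    IsStrategy ((n : ℝ)⁻¹ • ∑ j, X j) := by
  refine ⟨(Matrix.posSemidef_sum univ fun j _ => (hX j).1).smul (by positivity), fun b b' => ?_⟩
  have hn' : (n : ℂ) ≠ 0 := by exact_mod_cast hn
  simp only [Matrix.smul_apply, Matrix.sum_apply, ← Finset.smul_sum]
  rw [Finset.sum_comm]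
  simp only [(hX _).2, Finset.sum_const, Finset.card_univ, Fintype.card_fin]
  split_ifs <;> simp [hn']

theorem stmt4 {α β ι : Type*} [Fintype α] [Fintype β] [Fintype ι]
    [DecidableEq α] [DecidableEq β] [Nonempty α] [Nonempty β]
    (P : ι → Matrix (α × β) (α × β) ℂ) (hP : ∀ i, (P i).PosSemidef)
    (ρ : Matrix β β ℂ) (hρ : ρ.PosSemidef) (hρtr : ρ.trace = 1)
    (hPsum : ∑ i, P i =
      Matrix.of fun p q : α × β => (if p.1 = q.1 then (1 : ℂ) else 0) * ρ p.2 q.2)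
    (v : ι → ℝ) (n : ℕ) (hn : 1 ≤ n) :
    sSup {x : ℝ | ∃ X : Matrix (Fin n → α × β) (Fin n → α × β) ℂ,
        IsParStrategy n X ∧
        x = (1 / n) * ∑ s : Fin n → ι,
              (∑ j, v (s j)) * ((nKron (fun j => P (s j)) * X).trace).re}
      = sSup {x : ℝ | ∃ X : Matrix (α × β) (α × β) ℂ,
          IsStrategy X ∧
          x = ∑ i, v i * ((P i * X).trace).re} := by
  obtain ⟨m, rfl⟩ : ∃ m, n = m + 1 := ⟨n - 1, by omega⟩
  have hR := Matrix.posSemidef_sum univ fun i _ => hP i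
  rw [hPsum] at hR
  have hm : ((m + 1 : ℕ) : ℝ) ≠ 0 := by positivity
  have hval : ∀ X : Matrix (Fin (m + 1) → α × β) (Fin (m + 1) → α × β) ℂ,
      ∑ s : Fin (m + 1) → ι, (∑ j, v (s j)) * ((nKron (fun j => P (s j)) * X).trace).re =
        ∑ j, ∑ i, v i * ((P i * marginal (∑ i, P i) X j).trace).re := by
    intro X
    simp only [Finset.sum_mul]
    rw [Finset.sum_comm]
    refine Finset.sum_congr rfl fun j _ => ?_
    simpa using congrArg Complex.re (sum_trace_nKron P X (fun i => (v i : ℂ)) j)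
  congr 1
  ext x
  simp only [Set.mem_ofPred_eq, hval, hPsum]
  constructor
  · rintro ⟨X, hX, rfl⟩
    refine ⟨_, isStrategy_average hm fun j => marginal_isStrategy hρtr hX hR j, ?_⟩
    simp only [Matrix.mul_smul, Matrix.trace_smul, Matrix.trace_sum,
      Complex.smul_re, Complex.re_sum, smul_eq_mul, Finset.mul_sum]
    rw [Finset.sum_comm]
    refine Finset.sum_congr rfl fun i _ => Finset.sum_congr rfl fun j _ => ?_
    rw [one_div]
    ring
  · rintro ⟨X, hX, rfl⟩
    refine ⟨_, nKron_isParStrategy (m + 1) hX, ?_⟩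
    simp only [marginal_nKron hρtr hX, Finset.sum_const, Finset.card_univ, Fintype.card_fin,
      nsmul_eq_mul]
    field_simp
end

section
/- Let I be a finite type, let P₀, P₁, A be positive semidefinite matrices in Matrix I I ℂ with A ≥ P₁ in the Loewner order, let B := P₀ + P₁, and set f 0 := B, f 1 := A. Define matrices G n k indexed by (Fin n → I), for 0 ≤ k ≤ n, by: G n 0 = ⨂ⱼ B; G n n = ⨂ⱼ A; and for 0 < k < n, G n k = B ⊗ₖ G (n−1) k + A ⊗ₖ (∑_{s ∈ Σ^{n−1}_{k−1}} ⨂ⱼ f (s j)), identifying (Fin n → I) with I × (Fin (n−1) → I) by splitting off the first coordinate. Then for all 0 ≤ k ≤ n: (i) G n k ≥ ∑_{s ∈ Σ^n_{≥k}} ⨂ⱼ P_{s j} in the Loewner order; and (ii) if Tr B = 1 and Tr A = p then Tr (G n k) = p^k * (n.choose k). -/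
open Matrix Finset Kronecker ComplexOrder

/-- The set `Σ^n_{≥k}` of binary strings of length `n` with at least `k` ones. -/
def SigmaGe (n k : ℕ) : Finset (Fin n → Fin 2) :=
  Finset.univ.filter fun s => k ≤ (Finset.univ.filter fun j => s j = 1).card

/-- The set `Σ^n_k` of binary strings of length `n` with exactly `k` ones. -/
def SigmaEq (n k : ℕ) : Finset (Fin n → Fin 2) :=
  Finset.univ.filter fun s => (Finset.univ.filter fun j => s j = 1).card = k

/-- The recursively defined dual solution `G n k`, built from `A` (for a win) and
`B` (for either outcome), with `f 0 = B` and `f 1 = A`. -/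
noncomputable def dualG {I : Type*} [Fintype I] [DecidableEq I] (A B : Matrix I I ℂ) :
    (n : ℕ) → ℕ → Matrix (Fin n → I) (Fin n → I) ℂ
  | n, 0 => nKron (fun _ : Fin n => B)
  | 0, _ + 1 => 0
  | n + 1, k + 1 =>
    if k + 1 = n + 1 then nKron (fun _ : Fin (n + 1) => A)
    else
      Matrix.reindex (Fin.consEquiv fun _ : Fin (n + 1) => I) (Fin.consEquiv fun _ : Fin (n + 1) => I)
        (B ⊗ₖ dualG A B n (k + 1)
          + A ⊗ₖ ∑ s ∈ SigmaEq n k, nKron (fun j => if s j = 1 then A else B))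

section NKron

open scoped MatrixOrder

variable {I : Type*}

/-- The Kronecker product of `M` with a matrix indexed by `Fin n → I`, reindexed by
`Fin (n + 1) → I`. -/
noncomputable def kronCons {n : ℕ} (M : Matrix I I ℂ)
    (X : Matrix (Fin n → I) (Fin n → I) ℂ) : Matrix (Fin (n + 1) → I) (Fin (n + 1) → I) ℂ :=
  Matrix.reindex (Fin.consEquiv fun _ : Fin (n + 1) => I)
    (Fin.consEquiv fun _ : Fin (n + 1) => I) (M ⊗ₖ X)

lemma kronCons_apply {n : ℕ} (M : Matrix I I ℂ) (X : Matrix (Fin n → I) (Fin n → I) ℂ)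
    (f g : Fin (n + 1) → I) :
    kronCons M X f g = M (f 0) (g 0) * X (Fin.tail f) (Fin.tail g) := rfl

lemma kronCons_add {n : ℕ} (M : Matrix I I ℂ) (X Y : Matrix (Fin n → I) (Fin n → I) ℂ) :
    kronCons M (X + Y) = kronCons M X + kronCons M Y := by
  ext f g
  simp only [kronCons_apply, Matrix.add_apply, mul_add]

lemma add_kronCons {n : ℕ} (M N : Matrix I I ℂ) (X : Matrix (Fin n → I) (Fin n → I) ℂ) :
    kronCons (M + N) X = kronCons M X + kronCons N X := by
  ext f g
  simp only [kronCons_apply, Matrix.add_apply, add_mul]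

lemma kronCons_sum {n : ℕ} {ι : Type*} (M : Matrix I I ℂ) (s : Finset ι)
    (X : ι → Matrix (Fin n → I) (Fin n → I) ℂ) :
    kronCons M (∑ i ∈ s, X i) = ∑ i ∈ s, kronCons M (X i) := by
  ext f g
  simp only [kronCons_apply, Matrix.sum_apply, mul_sum]

variable [Fintype I]

lemma trace_kronCons {n : ℕ} (M : Matrix I I ℂ) (X : Matrix (Fin n → I) (Fin n → I) ℂ) :
    (kronCons M X).trace = M.trace * X.trace := by
  rw [← Matrix.trace_kronecker]
  exact (Fin.consEquiv fun _ : Fin (n + 1) => I).symm.sum_comp fun i => (M ⊗ₖ X) i i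

lemma kronCons_nonneg {n : ℕ} {M : Matrix I I ℂ} {X : Matrix (Fin n → I) (Fin n → I) ℂ}
    (hM : 0 ≤ M) (hX : 0 ≤ X) : 0 ≤ kronCons M X := by
  rw [Matrix.nonneg_iff_posSemidef] at *
  exact (hM.kronecker hX).submatrix _

lemma kronCons_le_kronCons {n : ℕ} {M N : Matrix I I ℂ}
    {X Y : Matrix (Fin n → I) (Fin n → I) ℂ} (hM : 0 ≤ M) (hMN : M ≤ N) (hXY : X ≤ Y)
    (hY : 0 ≤ Y) : kronCons M X ≤ kronCons N Y := by
  have h : kronCons N Y = kronCons M X + (kronCons (N - M) Y + kronCons M (Y - X)) := by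
    ext f g
    simp only [kronCons_apply, Matrix.add_apply, Matrix.sub_apply]
    ring
  rw [h]
  exact le_add_of_nonneg_right (add_nonneg (kronCons_nonneg (sub_nonneg.2 hMN) hY)
    (kronCons_nonneg hM (sub_nonneg.2 hXY)))

lemma nKron_succ {n : ℕ} (M : Fin (n + 1) → Matrix I I ℂ) :
    nKron M = kronCons (M 0) (nKron fun j => M j.succ) := by
  ext f g
  simp only [nKron, kronCons_apply, Fin.prod_univ_succ, Fin.tail]

lemma sum_sigmaGe_self (X Y : Matrix I I ℂ) (n : ℕ) :
    ∑ s ∈ SigmaGe n n, nKron (fun j => if s j = 1 then X else Y) = nKron fun _ => X := by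
  have h : SigmaGe n n = {fun _ => 1} := by
    ext s
    have hs : #{j | s j = 1} ≤ n := (card_le_univ _).trans_eq (Fintype.card_fin n)
    have := Finset.card_filter_eq_iff (s := univ) (p := fun j => s j = 1)
    simp only [card_univ, Fintype.card_fin, mem_univ, forall_const] at this
    simp only [SigmaGe, mem_filter_univ, mem_singleton, funext_iff, ← this]
    exact ⟨fun h => le_antisymm hs h, fun h => h.ge⟩
  simp [h]

lemma sum_sigmaGe_eq_add (X Y : Matrix I I ℂ) (n k : ℕ) :
    ∑ s ∈ SigmaGe n k, nKron (fun j => if s j = 1 then X else Y) =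
      ∑ s ∈ SigmaGe n (k + 1), nKron (fun j => if s j = 1 then X else Y) +
        ∑ s ∈ SigmaEq n k, nKron fun j => if s j = 1 then X else Y := by
  rw [← sum_union]
  · congr 1
    ext s
    simp only [SigmaGe, SigmaEq, mem_union, mem_filter_univ]
    omega
  · rw [disjoint_left]
    intro s
    simp only [SigmaGe, SigmaEq, mem_filter_univ]
    omega

lemma sum_nKron_succ (X Y : Matrix I I ℂ) (n : ℕ) (φ : ℕ → Prop) [DecidablePred φ] :
    (∑ s : Fin (n + 1) → Fin 2 with φ #{j | s j = 1}, nKron fun j => if s j = 1 then X else Y) =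
      kronCons Y (∑ s : Fin n → Fin 2 with φ #{j | s j = 1},
          nKron fun j => if s j = 1 then X else Y) +
        kronCons X (∑ s : Fin n → Fin 2 with φ (#{j | s j = 1} + 1),
          nKron fun j => if s j = 1 then X else Y) := by
  simp only [kronCons_sum, sum_filter]
  rw [← (Fin.consEquiv fun _ : Fin (n + 1) => Fin 2).sum_comp, Fintype.sum_prod_type,
    Fin.sum_univ_two]
  have kronCons_ite (M : Matrix I I ℂ) (p : Prop) [Decidable p]
      (Z : Matrix (Fin n → I) (Fin n → I) ℂ) :
      kronCons M (if p then Z else 0) = if p then kronCons M Z else 0 := by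
    split_ifs
    · rfl
    · ext f g
      simp [kronCons_apply]
  congr 1 <;> refine sum_congr rfl fun t _ => ?_ <;> rw [kronCons_ite] <;>
    refine if_congr ?_ ?_ rfl
  · rw [Fin.card_filter_univ_succ]
    simp [Fin.consEquiv]
  · rw [nKron_succ]
    simp [Fin.consEquiv]
  · rw [Fin.card_filter_univ_succ]
    simp [Fin.consEquiv]
  · rw [nKron_succ]
    simp [Fin.consEquiv]

lemma sum_sigmaGe_succ_succ (X Y : Matrix I I ℂ) (n k : ℕ) :
    ∑ s ∈ SigmaGe (n + 1) (k + 1), nKron (fun j => if s j = 1 then X else Y) =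
      kronCons (Y + X) (∑ s ∈ SigmaGe n (k + 1), nKron fun j => if s j = 1 then X else Y) +
        kronCons X (∑ s ∈ SigmaEq n k, nKron fun j => if s j = 1 then X else Y) := by
  rw [add_kronCons, add_assoc, ← kronCons_add, ← sum_sigmaGe_eq_add]
  simp only [SigmaGe]
  rw [sum_nKron_succ X Y n (fun m => k + 1 ≤ m)]
  simp only [add_le_add_iff_right]

variable [DecidableEq I]

lemma nKron_zero (M : Fin 0 → Matrix I I ℂ) : nKron M = 1 := by
  ext f g
  obtain rfl := Subsingleton.elim f g
  simp [nKron]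

lemma nKron_nonneg {n : ℕ} {M : Fin n → Matrix I I ℂ} (hM : ∀ j, 0 ≤ M j) : 0 ≤ nKron M := by
  induction n with
  | zero =>
    rw [nKron_zero, Matrix.nonneg_iff_posSemidef]
    exact Matrix.PosSemidef.one
  | succ n ih =>
    rw [nKron_succ]
    exact kronCons_nonneg (hM 0) (ih fun j => hM j.succ)

lemma nKron_le_nKron {n : ℕ} {M N : Fin n → Matrix I I ℂ} (hM : ∀ j, 0 ≤ M j)
    (hMN : ∀ j, M j ≤ N j) : nKron M ≤ nKron N := by
  induction n with
  | zero => rw [nKron_zero, nKron_zero]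
  | succ n ih =>
    rw [nKron_succ, nKron_succ]
    exact kronCons_le_kronCons (hM 0) (hMN 0) (ih (fun j => hM j.succ) fun j => hMN j.succ)
      (nKron_nonneg fun j => (hM j.succ).trans (hMN j.succ))

lemma trace_nKron {n : ℕ} (M : Fin n → Matrix I I ℂ) :
    (nKron M).trace = ∏ j, (M j).trace := by
  induction n with
  | zero => simp [nKron_zero]
  | succ n ih => rw [nKron_succ, trace_kronCons, ih, Fin.prod_univ_succ]

lemma sum_sigmaGe_zero (X Y : Matrix I I ℂ) (n : ℕ) :
    ∑ s ∈ SigmaGe n 0, nKron (fun j => if s j = 1 then X else Y) = nKron fun _ => Y + X := by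
  induction n with
  | zero => simp [SigmaGe, nKron_zero]
  | succ n ih =>
    simp only [SigmaGe] at ih ⊢
    rw [sum_nKron_succ X Y n (fun m => 0 ≤ m), nKron_succ]
    simp only [zero_le] at ih ⊢
    rw [ih, add_kronCons]

lemma trace_sum_sigmaEq {X Y : Matrix I I ℂ} (hY : Y.trace = 1) (n k : ℕ) :
    (∑ s ∈ SigmaEq n k, nKron fun j => if s j = 1 then X else Y).trace =
      X.trace ^ k * (n.choose k : ℂ) := by
  induction n generalizing k with
  | zero => cases k <;> simp [SigmaEq, nKron_zero]
  | succ n ih =>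
    simp only [SigmaEq] at ih ⊢
    rw [sum_nKron_succ X Y n (fun m => m = k), Matrix.trace_add, trace_kronCons, trace_kronCons,
      hY, ih]
    cases k with
    | zero => simp
    | succ k =>
      simp only [add_left_inj]
      rw [ih, Nat.choose_succ_succ]
      push_cast
      ring

lemma dualG_zero (A B : Matrix I I ℂ) (n : ℕ) : dualG A B n 0 = nKron fun _ => B := by
  cases n <;> rw [dualG]

lemma dualG_self (A B : Matrix I I ℂ) (n : ℕ) : dualG A B n n = nKron fun _ => A := by
  cases n with
  | zero => rw [dualG_zero, nKron_zero, nKron_zero]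
  | succ n => rw [dualG, if_pos rfl]

lemma dualG_succ_succ (A B : Matrix I I ℂ) {n k : ℕ} (hk : k < n) :
    dualG A B (n + 1) (k + 1) = kronCons B (dualG A B n (k + 1)) +
      kronCons A (∑ s ∈ SigmaEq n k, nKron fun j => if s j = 1 then A else B) := by
  rw [dualG, if_neg (by omega)]
  rfl

lemma sum_sigmaGe_le_dualG {P₀ P₁ A : Matrix I I ℂ} (hP₀ : 0 ≤ P₀) (hP₁ : 0 ≤ P₁)
    (hAP : P₁ ≤ A) {n k : ℕ} (hk : k ≤ n) :
    ∑ s ∈ SigmaGe n k, nKron (fun j => if s j = 1 then P₁ else P₀) ≤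
      dualG A (P₀ + P₁) n k := by
  have hA : 0 ≤ A := hP₁.trans hAP
  have hB : 0 ≤ P₀ + P₁ := add_nonneg hP₀ hP₁
  induction n generalizing k with
  | zero =>
    obtain rfl : k = 0 := by omega
    rw [dualG_zero, sum_sigmaGe_zero]
  | succ n ih =>
    cases k with
    | zero => rw [dualG_zero, sum_sigmaGe_zero]
    | succ k =>
      rcases hk.eq_or_lt with h | h
      · obtain rfl : k = n := by omega
        rw [dualG_self, sum_sigmaGe_self]
        exact nKron_le_nKron (fun _ => hP₁) fun _ => hAP
      · have ih' := ih (k := k + 1) (by omega)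
        rw [dualG_succ_succ A _ (by omega), sum_sigmaGe_succ_succ]
        refine add_le_add (kronCons_le_kronCons hB le_rfl ih' (le_trans ?_ ih'))
          (kronCons_le_kronCons hP₁ hAP (sum_le_sum fun s _ => nKron_le_nKron (fun j => ?_)
            fun j => ?_) (sum_nonneg fun s _ => nKron_nonneg fun j => ?_))
        · exact sum_nonneg fun s _ => nKron_nonneg fun j => by
            split_ifs
            exacts [hP₁, hP₀]
        · split_ifs
          exacts [hP₁, hP₀]
        · split_ifs
          exacts [hAP, le_add_of_nonneg_right hP₁]
        · split_ifs
          exacts [hA, hB]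

lemma trace_dualG {A B : Matrix I I ℂ} (hB : B.trace = 1) {n k : ℕ} (hk : k ≤ n) :
    (dualG A B n k).trace = A.trace ^ k * (n.choose k : ℂ) := by
  induction n generalizing k with
  | zero =>
    obtain rfl : k = 0 := by omega
    simp [dualG_zero, trace_nKron]
  | succ n ih =>
    cases k with
    | zero => simp [dualG_zero, trace_nKron, hB]
    | succ k =>
      rcases hk.eq_or_lt with h | h
      · obtain rfl : k = n := by omega
        simp [dualG_self, trace_nKron]
      · rw [dualG_succ_succ A _ (by omega), Matrix.trace_add, trace_kronCons, trace_kronCons,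
          hB, ih (by omega), trace_sum_sigmaEq hB, Nat.choose_succ_succ]
        push_cast
        ring

end NKron

theorem stmt10 {I : Type*} [Fintype I] [DecidableEq I]
    (P₀ P₁ A : Matrix I I ℂ)
    (hP₀ : P₀.PosSemidef) (hP₁ : P₁.PosSemidef) (hA : A.PosSemidef)
    (hAP : (A - P₁).PosSemidef)
    (n k : ℕ) (hk : k ≤ n) :
    ((dualG A (P₀ + P₁) n k
        - ∑ s ∈ SigmaGe n k, nKron (fun j => if s j = 1 then P₁ else P₀)).PosSemidef)
    ∧ ∀ p : ℂ, (P₀ + P₁).trace = 1 → A.trace = p →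
        (dualG A (P₀ + P₁) n k).trace = p ^ k * (n.choose k : ℂ) := by
  refine ⟨Matrix.le_iff.1 (sum_sigmaGe_le_dualG (Matrix.nonneg_iff_posSemidef.2 hP₀)
    (Matrix.nonneg_iff_posSemidef.2 hP₁) (Matrix.le_iff.2 hAP) hk), ?_⟩
  rintro p hB rfl
  exact trace_dualG hB hk
end
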